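/- arXiv:math/0209252 — 2 statements merged into one kernel-verified Lean document; each statement's English description precedes it below -/
import Mathlib

section
/- Let Q be a semigroup and let a,q ∈ Q with a ∈ H(Q) and q ≤_R a. Then the map φ_a : ρ(a,q) → ρ(a,q) given by φ_a(R_b) = R_{ab} is well defined and is an order automorphism of the partially ordered set ρ(a,q), with inverse the corresponding map φ_{a♯}. -/
universe u

variable {Q : Type u}

/-- `p ≤_L q` in a semigroup `Q`: `Q¹p ⊆ Q¹q`, i.e. `p = q` or `p = x*q` for some `x`. -/
def leL [Semigroup Q] (p q : Q) : Prop := p = q ∨ ∃ x, p = x * q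

/-- `p ≤_R q` in a semigroup `Q`: `pQ¹ ⊆ qQ¹`. -/
def leR [Semigroup Q] (p q : Q) : Prop := p = q ∨ ∃ x, p = q * x

/-- Green's relation `L`. -/
def GreenL [Semigroup Q] (p q : Q) : Prop := leL p q ∧ leL q p

/-- Green's relation `R`. -/
def GreenR [Semigroup Q] (p q : Q) : Prop := leR p q ∧ leR q p

/-- Green's relation `H = L ∩ R`. -/
def GreenH [Semigroup Q] (p q : Q) : Prop := GreenL p q ∧ GreenR p q

/-- Green's relation `D = L ∘ R`. -/
def GreenD [Semigroup Q] (p q : Q) : Prop := ∃ c, GreenL p c ∧ GreenR c q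

/-- `h` is the group inverse `q♯` of `q` (in the group `H`-class of `q`):
`q` and `h` commute, `qhq = q` and `hqh = h`.  This holds precisely when `q` lies in a
subgroup of `Q` and `h` is its group inverse there. -/
def IsGroupInverse [Semigroup Q] (q h : Q) : Prop :=
  q * h = h * q ∧ q * h * q = q ∧ h * q * h = h

/-- `q` lies in a subgroup of `Q` (i.e. `q ∈ H(Q)`, the `H`-class of `q` is a group). -/
def inSubgroup [Semigroup Q] (q : Q) : Prop := ∃ h, IsGroupInverse q h

/-- A semigroup is regular if every element `q` can be written `q = qxq`. -/
def Regular (Q : Type u) [Semigroup Q] : Prop := ∀ q : Q, ∃ x, q * x * q = q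

theorem leR_refl [Semigroup Q] (a : Q) : leR a a := Or.inl rfl

theorem leR_trans [Semigroup Q] {a b c : Q} (h1 : leR a b) (h2 : leR b c) : leR a c := by
  rcases h1 with rfl | ⟨x, rfl⟩
  · exact h2
  · rcases h2 with rfl | ⟨y, rfl⟩
    · exact Or.inr ⟨x, rfl⟩
    · exact Or.inr ⟨y * x, mul_assoc _ _ _⟩

/-- The setoid of Green's relation `R` on `Q`; its quotient is the set of `R`-classes. -/
def rSetoid (Q : Type u) [Semigroup Q] : Setoid Q :=
  ⟨GreenR, ⟨fun _ => ⟨Or.inl rfl, Or.inl rfl⟩, fun h => ⟨h.2, h.1⟩,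
    fun h1 h2 => ⟨leR_trans h1.1 h2.1, leR_trans h2.2 h1.2⟩⟩⟩

/-- The set of `R`-classes of `Q`. -/
def RClasses (Q : Type u) [Semigroup Q] := Quotient (rSetoid Q)

/-- The `R`-class of an element. -/
def RClassOf [Semigroup Q] (b : Q) : RClasses Q := Quotient.mk (rSetoid Q) b

/-- The partial order on `R`-classes induced by `≤_R`. -/
instance RClasses.instPartialOrder [Semigroup Q] : PartialOrder (RClasses Q) where
  le := Quotient.lift₂ leR (fun _ _ _ _ ha hb => propext
    ⟨fun h => leR_trans (leR_trans ha.2 h) hb.1, fun h => leR_trans (leR_trans ha.1 h) hb.2⟩)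
  le_refl := by
    intro x; induction x using Quotient.ind; exact Or.inl rfl
  le_trans := by
    intro x y z
    induction x using Quotient.ind; induction y using Quotient.ind; induction z using Quotient.ind
    exact leR_trans
  le_antisymm := by
    intro x y
    induction x using Quotient.ind; induction y using Quotient.ind
    intro h1 h2; exact Quotient.sound ⟨h1, h2⟩

/-- For `a, q ∈ Q`, `ρ(a,q)` is the set of `R`-classes `{ R_b : b D q and b ≤_R a }`,
partially ordered by the order induced by `≤_R`. -/
def rho [Semigroup Q] (a q : Q) : Set (RClasses Q) :=
  { x | ∃ b : Q, x = RClassOf b ∧ GreenD b q ∧ leR b a }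

theorem leR_mul_left [Semigroup Q] {b c : Q} (a : Q) (h : leR b c) : leR (a * b) (a * c) := by
  rcases h with rfl | ⟨x, rfl⟩
  · exact leR_refl _
  · exact Or.inr ⟨x, (mul_assoc _ _ _).symm⟩

theorem leL_trans [Semigroup Q] {a b c : Q} (h1 : leL a b) (h2 : leL b c) : leL a c := by
  rcases h1 with rfl | ⟨x, rfl⟩
  · exact h2
  · rcases h2 with rfl | ⟨y, rfl⟩
    · exact Or.inr ⟨x, rfl⟩
    · exact Or.inr ⟨x * y, (mul_assoc _ _ _).symm⟩

theorem GreenL.trans [Semigroup Q] {a b c : Q} (h1 : GreenL a b) (h2 : GreenL b c) :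
    GreenL a c :=
  ⟨leL_trans h1.1 h2.1, leL_trans h2.2 h1.2⟩

theorem IsGroupInverse.symm [Semigroup Q] {a h : Q} (ha : IsGroupInverse a h) :
    IsGroupInverse h a :=
  ⟨ha.1.symm, ha.2.2, ha.2.1⟩

/-- The idempotent `a♯a` fixes from the left everything `≤_R`-below `a`. -/
theorem IsGroupInverse.mul_mul_cancel [Semigroup Q] {a h b : Q} (ha : IsGroupInverse a h)
    (hb : leR b a) : h * (a * b) = b := by
  have key : h * a * a = a := by rw [← ha.1, ha.2.1]
  rw [← mul_assoc]
  rcases hb with rfl | ⟨x, rfl⟩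
  · exact key
  · rw [← mul_assoc, key]

theorem IsGroupInverse.leR [Semigroup Q] {a h : Q} (ha : IsGroupInverse a h) : leR h a :=
  Or.inr ⟨h * h, by rw [← mul_assoc, ha.1, ha.2.2]⟩

theorem IsGroupInverse.rho_eq [Semigroup Q] {a h : Q} (ha : IsGroupInverse a h) (q : Q) :
    rho a q = rho h q := by
  ext x
  constructor
  · rintro ⟨b, hx, hD, hb⟩
    exact ⟨b, hx, hD, leR_trans hb ha.symm.leR⟩
  · rintro ⟨b, hx, hD, hb⟩
    exact ⟨b, hx, hD, leR_trans hb ha.leR⟩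

/-- Left multiplication by `a` on `R`-classes, `R_b ↦ R_{ab}`. -/
def RClasses.mulLeft [Semigroup Q] (a : Q) : RClasses Q → RClasses Q :=
  Quotient.map (sa := rSetoid Q) (sb := rSetoid Q) (fun b => a * b)
    (fun _ _ h => ⟨leR_mul_left a h.1, leR_mul_left a h.2⟩)

theorem RClasses.mulLeft_mono [Semigroup Q] (a : Q) : Monotone (RClasses.mulLeft a) := by
  intro x y
  induction x using Quotient.ind
  induction y using Quotient.ind
  exact leR_mul_left a

theorem IsGroupInverse.mulLeft_mem_rho [Semigroup Q] {a h q : Q} (ha : IsGroupInverse a h)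
    {x : RClasses Q} (hx : x ∈ rho a q) : RClasses.mulLeft a x ∈ rho a q := by
  obtain ⟨b, rfl, ⟨c, hbc, hcq⟩, hb⟩ := hx
  have hL : GreenL (a * b) b := ⟨Or.inr ⟨a, rfl⟩, Or.inr ⟨h, (ha.mul_mul_cancel hb).symm⟩⟩
  exact ⟨a * b, rfl, ⟨c, hL.trans hbc, hcq⟩, Or.inr ⟨b, rfl⟩⟩

theorem IsGroupInverse.mulLeft_mulLeft [Semigroup Q] {a h q : Q} (ha : IsGroupInverse a h)
    {x : RClasses Q} (hx : x ∈ rho a q) : RClasses.mulLeft h (RClasses.mulLeft a x) = x := by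
  obtain ⟨b, rfl, -, hb⟩ := hx
  exact congrArg RClassOf (ha.mul_mul_cancel hb)

/-- The order automorphism `R_b ↦ R_{ab}` of `ρ(a,q)`, with inverse `R_b ↦ R_{a♯b}`. -/
def IsGroupInverse.rhoOrderIso [Semigroup Q] {a h : Q} (ha : IsGroupInverse a h) (q : Q) :
    ↥(rho a q) ≃o ↥(rho a q) :=
  Equiv.toOrderIso
    { toFun := fun x => ⟨RClasses.mulLeft a x, ha.mulLeft_mem_rho x.2⟩
      invFun := fun x => ⟨RClasses.mulLeft h x,
        (ha.rho_eq q).ge (ha.symm.mulLeft_mem_rho ((ha.rho_eq q).le x.2))⟩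
      left_inv := fun x => Subtype.ext (ha.mulLeft_mulLeft x.2)
      right_inv := fun x => Subtype.ext (ha.symm.mulLeft_mulLeft ((ha.rho_eq q).le x.2)) }
    (fun _ _ hxy => RClasses.mulLeft_mono a hxy)
    (fun _ _ hxy => RClasses.mulLeft_mono h hxy)

/-- Lemma 3.5: let `Q` be a semigroup and `a, q ∈ Q` with `a ∈ H(Q)` (with group inverse
`a♯`) and `q ≤_R a`.  Then `φ_a : ρ(a,q) → ρ(a,q)`, `R_b ↦ R_{ab}`, is well defined and
is an order automorphism of `ρ(a,q)` with inverse the corresponding map `φ_{a♯}`. -/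
theorem phi_order_automorphism {Q : Type u} [Semigroup Q] (a q asharp : Q)
    (ha : IsGroupInverse a asharp) (hq : leR q a) :
    ∃ φ : ↥(rho a q) ≃o ↥(rho a q),
      (∀ (b : Q) (hb : RClassOf b ∈ rho a q),
        (φ ⟨RClassOf b, hb⟩ : RClasses Q) = RClassOf (a * b)) ∧
      (∀ (b : Q) (hb : RClassOf b ∈ rho a q),
        (φ.symm ⟨RClassOf b, hb⟩ : RClasses Q) = RClassOf (asharp * b)) := by
  exact ⟨ha.rhoOrderIso q, fun _ _ => rfl, fun _ _ => rfl⟩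
end

section
/- Let S be a weak left order in a semigroup Q and let q ∈ Q be such that q = a♯b where a,b ∈ S and b ≤_R a in Q. If the image φ̄_{a,q}(⟨a⟩) is a finite group, then S ∩ H_q ≠ ∅. -/
universe u

variable {Q : Type u}

/-- `S` is a weak left order in `Q`: every element of `Q` is `a♯ * b` with `a, b ∈ S`. -/
def IsWeakLeftOrder [Semigroup Q] (S : Set Q) : Prop :=
  ∀ q : Q, ∃ a ∈ S, ∃ b ∈ S, ∃ c, IsGroupInverse a c ∧ q = c * b

/-- `S` is a straight weak left order in `Q`: every element of `Q` is `a♯ * b` with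
`a, b ∈ S` and `a R b` in `Q`. -/
def IsStraightWeakLeftOrder [Semigroup Q] (S : Set Q) : Prop :=
  ∀ q : Q, ∃ a ∈ S, ∃ b ∈ S, (∃ c, IsGroupInverse a c ∧ q = c * b) ∧ GreenR a b

/-- `S` is a weak right order in `Q`: every element of `Q` is `b * a♯` with `a, b ∈ S`. -/
def IsWeakRightOrder [Semigroup Q] (S : Set Q) : Prop :=
  ∀ q : Q, ∃ a ∈ S, ∃ b ∈ S, ∃ c, IsGroupInverse a c ∧ q = b * c

/-- `S` is a straight weak right order in `Q`: every element of `Q` is `b * a♯` with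
`a, b ∈ S` and `a L b` in `Q`. -/
def IsStraightWeakRightOrder [Semigroup Q] (S : Set Q) : Prop :=
  ∀ q : Q, ∃ a ∈ S, ∃ b ∈ S, (∃ c, IsGroupInverse a c ∧ q = b * c) ∧ GreenL a b

/-- `S` is very large in `Q`: it meets every `H`-class of `Q`. -/
def VeryLarge [Semigroup Q] (S : Set Q) : Prop := ∀ q : Q, ∃ s ∈ S, GreenH s q

/-- `S` is a local left order in `Q`: for every group `H`-class (the `H`-class of an
element `e` lying in a subgroup), every element of that `H`-class is `a⁻¹ * b` for some
`a, b ∈ S` lying in that `H`-class, `a⁻¹` being the group inverse of `a`. -/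
def IsLocalLeftOrder [Semigroup Q] (S : Set Q) : Prop :=
  ∀ e : Q, inSubgroup e → ∀ q : Q, GreenH q e →
    ∃ a ∈ S, ∃ b ∈ S, GreenH a e ∧ GreenH b e ∧ ∃ c, IsGroupInverse a c ∧ q = c * b

/-- `npow1 x n = x^(n+1)` in a semigroup. -/
def npow1 [Semigroup Q] (x : Q) : ℕ → Q
  | 0 => x
  | n + 1 => npow1 x n * x

/-- Integer powers of an element `a` lying in a subgroup, with group inverse `a'`:
`gpow a a' 0 = a * a'` (the identity of the group `H`-class), `gpow a a' n = aⁿ` for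
`n > 0` and `gpow a a' (-n) = (a')ⁿ` for `n > 0`.  The set of all these powers is the
cyclic subgroup `⟨a⟩` of `H_a` generated by `a`. -/
def gpow [Semigroup Q] (a a' : Q) : ℤ → Q
  | Int.ofNat 0 => a * a'
  | Int.ofNat (n + 1) => npow1 a n
  | Int.negSucc n => npow1 a' n

theorem GreenR.mul_left [Semigroup Q] {p q : Q} (h : GreenR p q) (c : Q) :
    GreenR (c * p) (c * q) := by
  have key : ∀ {x y : Q}, leR x y → leR (c * x) (c * y) := by
    rintro x y (rfl | ⟨z, rfl⟩)
    · exact Or.inl rfl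
    · exact Or.inr ⟨z, (mul_assoc _ _ _).symm⟩
  exact ⟨key h.1, key h.2⟩

theorem npow1_succ_left [Semigroup Q] (a : Q) (n : ℕ) : npow1 a (n + 1) = a * npow1 a n := by
  induction n with
  | zero => rfl
  | succ n ih =>
    change npow1 a (n + 1) * a = a * (npow1 a n * a)
    rw [ih, mul_assoc]

namespace IsGroupInverse

variable [Semigroup Q] {a h : Q}

theorem inv_mul_npow1_succ (ha : IsGroupInverse a h) (n : ℕ) :
    h * npow1 a (n + 1) = npow1 a n := by
  induction n with
  | zero =>
    change h * (a * a) = a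
    rw [← mul_assoc, ← ha.1, ha.2.1]
  | succ n ih =>
    change h * (npow1 a (n + 1) * a) = npow1 a n * a
    rw [← mul_assoc, ih]

theorem leL_npow1_mul (ha : IsGroupInverse a h) {q : Q} (hq : h * (a * q) = q) (n : ℕ) :
    leL q (npow1 a n * q) := by
  induction n with
  | zero => exact Or.inr ⟨h, hq.symm⟩
  | succ n ih =>
    refine leL_trans ih (Or.inr ⟨h, ?_⟩)
    rw [← mul_assoc, ha.inv_mul_npow1_succ]

/-- If two distinct positive powers of `a` move `q` into the same `R`-class, then some positive
power of `a` fixes the `R`-class of `q`. -/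
theorem exists_greenR_npow1_mul (ha : IsGroupInverse a h) {q : Q} (hq : h * (a * q) = q)
    {i j : ℕ} (hij : i < j) (hR : GreenR (npow1 a i * q) (npow1 a j * q)) :
    ∃ k, GreenR (npow1 a k * q) q := by
  induction i generalizing j with
  | zero =>
    obtain ⟨k, rfl⟩ : ∃ k, j = k + 1 := ⟨j - 1, by omega⟩
    have hR' := hR.mul_left h
    rw [← mul_assoc h (npow1 a (k + 1)), ha.inv_mul_npow1_succ] at hR'
    change GreenR (h * (a * q)) _ at hR'
    rw [hq] at hR'
    exact ⟨k, hR'.2, hR'.1⟩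
  | succ i ih =>
    obtain ⟨k, rfl⟩ : ∃ k, j = k + 1 := ⟨j - 1, by omega⟩
    have hR' := hR.mul_left h
    rw [← mul_assoc, ← mul_assoc, ha.inv_mul_npow1_succ, ha.inv_mul_npow1_succ] at hR'
    exact ih (by omega) hR'

end IsGroupInverse

/-- Proposition 3.8: let `S` be a weak left order in `Q` and let `q ∈ Q` be such that
`q = a♯ * b` where `a, b ∈ S` and `b ≤_R a` in `Q`.  If the image `φ̄_{a,q}(⟨a⟩)` of the
homomorphism `φ̄_{a,q} : ⟨a⟩ → A(ρ(a,q))`, `aⁱ ↦ φ_{aⁱ}`, is finite, then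
`S ∩ H_q ≠ ∅`. -/
theorem finite_image_meets_H {Q : Type u} [Semigroup Q] (S : Subsemigroup Q)
    (hS : IsWeakLeftOrder (S : Set Q)) (q a b asharp : Q)
    (haS : a ∈ S) (hbS : b ∈ S)
    (ha : IsGroupInverse a asharp) (hb : leR b a) (hq : q = asharp * b)
    (Phi : ℤ → (↥(rho a q) ≃o ↥(rho a q)))
    (hPhi : ∀ (i : ℤ) (c : Q) (hc : RClassOf c ∈ rho a q),
      ((Phi i) ⟨RClassOf c, hc⟩ : RClasses Q) = RClassOf (gpow a asharp i * c))
    (hfin : (Set.range Phi).Finite) :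
    ∃ s ∈ S, GreenH s q := by
  have heb : a * (asharp * b) = b := by
    rcases hb with rfl | ⟨x, rfl⟩
    · rw [← mul_assoc, ha.2.1]
    · rw [← mul_assoc, ← mul_assoc, ha.2.1]
  have haq : a * q = b := by rw [hq, heb]
  have hhq : asharp * (a * q) = q := by rw [haq, hq]
  have hmem : RClassOf q ∈ rho a q := by
    refine ⟨q, rfl, ⟨q, ⟨Or.inl rfl, Or.inl rfl⟩, Or.inl rfl, Or.inl rfl⟩, Or.inr ⟨asharp * q, ?_⟩⟩
    rw [← mul_assoc, ha.1, mul_assoc, hhq]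
  have := hfin.to_subtype
  obtain ⟨i, j, hij, hPhi_eq⟩ := Finite.exists_ne_map_eq_of_infinite
    (fun n : ℕ => (⟨Phi (Int.ofNat (n + 1)), Set.mem_range_self _⟩ : Set.range Phi))
  have hR : GreenR (npow1 a i * q) (npow1 a j * q) := by
    refine Quotient.exact (s := rSetoid Q) ?_
    have hi := hPhi (Int.ofNat (i + 1)) q hmem
    rw [Subtype.mk.inj hPhi_eq] at hi
    exact hi.symm.trans (hPhi (Int.ofNat (j + 1)) q hmem)
  obtain ⟨k, hk⟩ : ∃ k, GreenR (npow1 a k * q) q := by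
    rcases lt_or_gt_of_ne hij with h | h
    · exact ha.exists_greenR_npow1_mul hhq h hR
    · exact ha.exists_greenR_npow1_mul hhq h ⟨hR.2, hR.1⟩
  have hS_mem : ∀ n, npow1 a n * q ∈ S := by
    intro n
    induction n with
    | zero => exact haq.symm ▸ hbS
    | succ n ih =>
      rw [npow1_succ_left, mul_assoc]
      exact S.mul_mem haS ih
  exact ⟨_, hS_mem k, ⟨Or.inr ⟨_, rfl⟩, ha.leL_npow1_mul hhq k⟩, hk⟩
end
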